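/- arXiv:1601.02754 — 2 statements merged into one kernel-verified Lean document; each statement's English description precedes it below -/
import Mathlib

section
/- Let E, F, G be Hilbert spaces (over ℝ or ℂ), and let f : E → G and g : F → G be bounded (continuous) linear maps. Then the range of f is contained in the range of g if and only if there exists a constant γ > 0 such that ‖f† z‖ ≤ γ ‖g† z‖ for every z ∈ G. -/
open ContinuousLinearMap in
/-- If every value of `f` is a value of `g`, then uniform boundedness of the normalized functionals
`‖g† z‖⁻¹ • ⟪f† z, ·⟫` yields a bound of `f†` by `g†`. -/
theorem exists_adjoint_norm_le_of_range_subset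
    {𝕜 E F G : Type*} [RCLike 𝕜]
    [NormedAddCommGroup E] [InnerProductSpace 𝕜 E] [CompleteSpace E]
    [NormedAddCommGroup F] [InnerProductSpace 𝕜 F] [CompleteSpace F]
    [NormedAddCommGroup G] [InnerProductSpace 𝕜 G] [CompleteSpace G]
    {f : E →L[𝕜] G} {g : F →L[𝕜] G} (h : Set.range f ⊆ Set.range g) :
    ∃ γ : ℝ, 0 < γ ∧ ∀ z : G, ‖adjoint f z‖ ≤ γ * ‖adjoint g z‖ := by
  have inner_eq {x : E} {y : F} (hy : g y = f x) (z : G) :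
      inner 𝕜 (adjoint f z) x = inner 𝕜 (adjoint g z) y := by
    rw [adjoint_inner_left, adjoint_inner_left, hy]
  obtain ⟨C, hC⟩ := banach_steinhaus
    (g := fun z : G => ((‖adjoint g z‖⁻¹ : ℝ) : 𝕜) • innerSL 𝕜 (adjoint f z)) (fun x => by
      obtain ⟨y, hy⟩ := h ⟨x, rfl⟩
      refine ⟨‖y‖, fun z => ?_⟩
      rw [smul_apply, innerSL_apply_apply, inner_eq hy, norm_smul, RCLike.norm_ofReal,
        abs_inv, abs_norm]
      exact inv_mul_le_of_le_mul₀ (norm_nonneg _) (norm_nonneg _) (norm_inner_le_norm _ _))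
  refine ⟨max C 1, by positivity, fun z => ?_⟩
  rcases eq_or_ne (adjoint g z) 0 with hz | hz
  · obtain ⟨y, hy⟩ := h ⟨adjoint f z, rfl⟩
    have hfz : adjoint f z = 0 := by
      rw [← inner_self_eq_zero (𝕜 := 𝕜), inner_eq hy, hz, inner_zero_left]
    simp [hfz, hz]
  · have hle := hC z
    rw [norm_smul, RCLike.norm_ofReal, abs_inv, abs_norm, innerSL_apply_norm,
      inv_mul_le_iff₀ (norm_pos_iff.mpr hz), mul_comm] at hle
    exact hle.trans (by gcongr; exact le_max_left _ _)

open ContinuousLinearMap in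
/-- If `z ↦ ⟪v, z⟫` is bounded by a multiple of `‖g† z‖`, then `v` is in the range of `g`. -/
theorem mem_range_of_norm_inner_le_adjoint
    {𝕜 F G : Type*} [RCLike 𝕜]
    [NormedAddCommGroup F] [InnerProductSpace 𝕜 F] [CompleteSpace F]
    [NormedAddCommGroup G] [InnerProductSpace 𝕜 G] [CompleteSpace G]
    {g : F →L[𝕜] G} {v : G} {C : ℝ} (h : ∀ z : G, ‖inner 𝕜 v z‖ ≤ C * ‖adjoint g z‖) :
    v ∈ Set.range g := by
  obtain ⟨L, hL, -⟩ := exists_extension_norm_eq _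
    ((innerSL 𝕜 v).toLinearMap.compLeftInverse (adjoint g).toLinearMap)
  refine ⟨(InnerProductSpace.toDual 𝕜 F).symm L, ext_inner_right 𝕜 fun z => ?_⟩
  rw [← adjoint_inner_right, InnerProductSpace.toDual_symm_apply]
  exact (hL ⟨adjoint g z, z, rfl⟩).trans
    (LinearMap.compLeftInverse_apply_of_bdd _ _ ⟨C, h⟩ z _ rfl)

/-- Range-inclusion (Douglas) lemma: for bounded linear maps `f : E →L[𝕜] G` and
`g : F →L[𝕜] G` between Hilbert spaces, `range f ⊆ range g` iff there is `γ > 0`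
with `‖f† z‖ ≤ γ * ‖g† z‖` for all `z ∈ G`. -/
theorem range_subset_iff_adjoint_norm_le
    {𝕜 E F G : Type*} [RCLike 𝕜]
    [NormedAddCommGroup E] [InnerProductSpace 𝕜 E] [CompleteSpace E]
    [NormedAddCommGroup F] [InnerProductSpace 𝕜 F] [CompleteSpace F]
    [NormedAddCommGroup G] [InnerProductSpace 𝕜 G] [CompleteSpace G]
    (f : E →L[𝕜] G) (g : F →L[𝕜] G) :
    Set.range f ⊆ Set.range g ↔
      ∃ γ : ℝ, 0 < γ ∧ ∀ z : G,
        ‖ContinuousLinearMap.adjoint f z‖ ≤ γ * ‖ContinuousLinearMap.adjoint g z‖ := by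
  refine ⟨exists_adjoint_norm_le_of_range_subset, ?_⟩
  rintro ⟨γ, -, hγ⟩ _ ⟨x, rfl⟩
  refine mem_range_of_norm_inner_le_adjoint (C := ‖x‖ * γ) fun z => ?_
  rw [← ContinuousLinearMap.adjoint_inner_right, mul_assoc]
  exact (norm_inner_le_norm _ _).trans (by gcongr; exact hγ z)
end

section
/- For every real α with 0 < α ≤ 1 and every real x, one has E_{α,α}(x) > 0, i.e. ∑_{n=0}^∞ xⁿ / Γ(αn + α) > 0 (in particular this holds for negative arguments x = λ t^α with λ < 0, t ≥ 0). -/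
open Filter Topology Finset

/-- Rising-factorial formula for the coefficients of `(1 - z) ^ (-s)`. -/
lemma multichoose_eq_prod_div (s : ℝ) (n : ℕ) :
    Ring.multichoose s n = (∏ i ∈ range n, (s + i)) / n.factorial := by
  have hprod : (ascPochhammer ℝ n).eval s = ∏ i ∈ range n, (s + i) := by
    induction n with
    | zero => simp
    | succ n ih => rw [ascPochhammer_succ_eval, prod_range_succ, ih]
  rw [← hprod, ← Polynomial.ascPochhammer_smeval_eq_eval,
    ← Ring.factorial_nsmul_multichoose_eq_ascPochhammer, nsmul_eq_mul]
  field_simp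

lemma multichoose_eq_neg_one_pow_mul_choose (s : ℝ) (n : ℕ) :
    Ring.multichoose s n = (-1) ^ n * Ring.choose (-s) n := by
  rw [Ring.choose_neg', Int.negOnePow_def]
  simp [Units.smul_def, ← mul_assoc, ← mul_pow]

/-- Chu–Vandermonde: `(1 - z) ^ (-r) * (1 - z) ^ (-s) = (1 - z) ^ (-(r + s))`. -/
lemma multichoose_add (r s : ℝ) (n : ℕ) :
    Ring.multichoose (r + s) n =
      ∑ k ∈ range (n + 1), Ring.multichoose r (n - k) * Ring.multichoose s k := by
  rw [multichoose_eq_neg_one_pow_mul_choose, neg_add, add_comm,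
    Ring.add_choose_eq n (Commute.all _ _), Nat.sum_antidiagonal_eq_sum_range_succ_mk, mul_sum]
  refine sum_congr rfl fun k hk => ?_
  obtain ⟨d, rfl⟩ := Nat.exists_eq_add_of_le (Nat.lt_succ_iff.mp (mem_range.mp hk))
  simp only [multichoose_eq_neg_one_pow_mul_choose, Nat.add_sub_cancel_left, pow_add]
  ring

lemma multichoose_nonneg {s : ℝ} (hs : 0 ≤ s) (n : ℕ) : 0 ≤ Ring.multichoose s n := by
  rw [multichoose_eq_prod_div]
  positivity

lemma multichoose_neg_nonpos {a : ℝ} (h0 : 0 ≤ a) (h1 : a ≤ 1) {n : ℕ} (hn : n ≠ 0) :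
    Ring.multichoose (-a) n ≤ 0 := by
  obtain ⟨m, rfl⟩ := Nat.exists_eq_succ_of_ne_zero hn
  rw [multichoose_eq_prod_div, prod_range_succ']
  refine div_nonpos_of_nonpos_of_nonneg
    (mul_nonpos_of_nonneg_of_nonpos (prod_nonneg fun i _ => ?_) (by simpa using h0)) (by positivity)
  push_cast
  linarith [(Nat.cast_nonneg i : (0 : ℝ) ≤ i)]

lemma multichoose_le_choose {s : ℝ} (hs : 0 ≤ s) {j : ℕ} (h : s ≤ j + 1) (n : ℕ) :
    Ring.multichoose s n ≤ ((j + n).choose n : ℝ) := by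
  have key : Ring.multichoose ((j : ℝ) + 1) n = ((j + n).choose n : ℝ) := by
    rw [Ring.multichoose_eq, ← Ring.choose_natCast]
    congr 1
    push_cast
    ring
  rw [← key, multichoose_eq_prod_div, multichoose_eq_prod_div]
  gcongr

lemma summable_pow_mul_multichoose {a : ℝ} (h0 : 0 ≤ a) (h1 : a ≤ 1) {x : ℝ} (hx : |x| < 1)
    (n : ℕ) : Summable fun j : ℕ => x ^ j * Ring.multichoose (a * j + a) n := by
  refine Summable.of_norm_bounded
    (summable_choose_mul_geometric_of_norm_lt_one (R := ℝ) n (r := |x|) (by simpa using hx)) ?_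
  intro j
  have hs : 0 ≤ a * j + a := by positivity
  rw [norm_mul, norm_pow, Real.norm_eq_abs, Real.norm_eq_abs,
    abs_of_nonneg (multichoose_nonneg hs n), mul_comm]
  gcongr
  refine multichoose_le_choose hs ?_ n
  nlinarith [(Nat.cast_nonneg j : (0 : ℝ) ≤ j)]

/-- The `n`-th Taylor coefficient of `1 / ((1 - z) ^ a + y)`, expanded in powers of `y`. -/
noncomputable def resolventCoeff (a y : ℝ) (n : ℕ) : ℝ :=
  ∑' j : ℕ, (-y) ^ j * Ring.multichoose (a * j + a) n

lemma resolventCoeff_recurrence {a : ℝ} (h0 : 0 ≤ a) (h1 : a ≤ 1) {y : ℝ} (hy : |y| < 1)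
    (n : ℕ) :
    (1 + y) * resolventCoeff a y n = Ring.multichoose 0 n +
      ∑ k ∈ range n, -Ring.multichoose (-a) (n - k) * resolventCoeff a y k := by
  have hy' : |-y| < 1 := by rwa [abs_neg]
  have hsum := summable_pow_mul_multichoose h0 h1 hy'
  have hconv : ∑ k ∈ range (n + 1), Ring.multichoose (-a) (n - k) * resolventCoeff a y k =
      ∑' j : ℕ, (-y) ^ j * Ring.multichoose (a * j) n := by
    simp only [resolventCoeff, ← tsum_mul_left]
    rw [← Summable.tsum_finsetSum fun k _ => (hsum k).mul_left _]
    refine tsum_congr fun j => ?_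
    rw [show a * j = -a + (a * j + a) by ring, multichoose_add, mul_sum]
    refine sum_congr rfl fun k _ => ?_
    ring_nf
  have hshift : ∑' j : ℕ, (-y) ^ j * Ring.multichoose (a * j) n =
      Ring.multichoose 0 n - y * resolventCoeff a y n := by
    have hterm : ∀ j : ℕ, (-y) ^ (j + 1) * Ring.multichoose (a * (j + 1 : ℕ)) n =
        -y * ((-y) ^ j * Ring.multichoose (a * j + a) n) := fun j => by
      push_cast
      rw [mul_add, mul_one]
      ring
    have hs : Summable fun j : ℕ => (-y) ^ j * Ring.multichoose (a * j) n := by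
      rw [← summable_nat_add_iff 1]
      simpa only [hterm] using (hsum n).mul_left (-y)
    rw [hs.tsum_eq_zero_add]
    simp only [hterm, tsum_mul_left, resolventCoeff]
    simp
    ring
  rw [hshift, sum_range_succ, Nat.sub_self, Ring.multichoose_zero_right] at hconv
  simp only [neg_mul, sum_neg_distrib]
  linarith

lemma resolventCoeff_nonneg {a : ℝ} (h0 : 0 ≤ a) (h1 : a ≤ 1) {y : ℝ} (hy0 : 0 ≤ y)
    (hy1 : y < 1) (n : ℕ) : 0 ≤ resolventCoeff a y n := by
  induction n using Nat.strong_induction_on with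
  | _ n ih =>
    refine nonneg_of_mul_nonneg_right (a := 1 + y) ?_ (by linarith)
    rw [resolventCoeff_recurrence h0 h1 (by rwa [abs_of_nonneg hy0])]
    refine add_nonneg (multichoose_nonneg le_rfl n) (sum_nonneg fun k hk => ?_)
    have hk := mem_range.mp hk
    exact mul_nonneg (neg_nonneg.mpr (multichoose_neg_nonpos h0 h1 (by omega))) (ih k hk)

lemma resolventCoeff_anti {a : ℝ} (h0 : 0 ≤ a) (h1 : a ≤ 1) {y z : ℝ} (hy : 0 ≤ y)
    (hyz : y ≤ z) (hz : z < 1) (n : ℕ) : resolventCoeff a z n ≤ resolventCoeff a y n := by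
  induction n using Nat.strong_induction_on with
  | _ n ih =>
    have hle : (1 + z) * resolventCoeff a z n ≤ (1 + y) * resolventCoeff a y n := by
      rw [resolventCoeff_recurrence h0 h1 (by rw [abs_of_nonneg] <;> linarith),
        resolventCoeff_recurrence h0 h1 (by rw [abs_of_nonneg] <;> linarith)]
      gcongr with k hk
      · have hk := mem_range.mp hk
        exact neg_nonneg.mpr (multichoose_neg_nonpos h0 h1 (by omega))
      · exact ih k (mem_range.mp hk)
    nlinarith [resolventCoeff_nonneg h0 h1 (hy.trans hyz) hz n]

lemma gammaSeq_pos {s : ℝ} (hs : 0 < s) {n : ℕ} (hn : n ≠ 0) : 0 < Real.GammaSeq s n := by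
  have : 0 < n := Nat.pos_of_ne_zero hn
  unfold Real.GammaSeq
  positivity

lemma gammaSeq_le_succ {s : ℝ} (hs : 0 < s) {n : ℕ} (hn : n ≠ 0) :
    Real.GammaSeq s n ≤ Real.GammaSeq s (n + 1) := by
  have hn' : (0 : ℝ) < n := by exact_mod_cast Nat.pos_of_ne_zero hn
  have hbern : (n : ℝ) ^ s * (s + (n + 1)) ≤ ((n : ℝ) + 1) ^ s * (n + 1) := by
    have hlog : s * (1 / (n + 1)) ≤ s * Real.log ((n + 1) / n) := by
      have hinv : 1 / ((n : ℝ) + 1) = 1 - (((n : ℝ) + 1) / n)⁻¹ := by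
        field_simp
        ring
      rw [hinv]
      gcongr
      exact Real.one_sub_inv_le_log_of_pos (by positivity)
    have hexp : s * (1 / (n + 1)) + 1 ≤ (((n : ℝ) + 1) / n) ^ s := by
      rw [Real.rpow_def_of_pos (by positivity), mul_comm (Real.log _)]
      exact (add_le_add_left hlog 1).trans (Real.add_one_le_exp _)
    rw [Real.div_rpow (by positivity) hn'.le, le_div_iff₀ (by positivity)] at hexp
    calc (n : ℝ) ^ s * (s + (n + 1)) = (s * (1 / (n + 1)) + 1) * (n : ℝ) ^ s * (n + 1) := by
          field_simp
      _ ≤ _ := by gcongr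
  unfold Real.GammaSeq
  rw [prod_range_succ _ (n + 1), Nat.factorial_succ]
  push_cast
  rw [div_le_div_iff₀ (by positivity) (by positivity)]
  calc _ = ((n : ℝ) ^ s * (s + (n + 1))) *
        (n.factorial * ∏ j ∈ range (n + 1), (s + (j : ℝ))) := by ring
    _ ≤ (((n : ℝ) + 1) ^ s * (n + 1)) * (n.factorial * ∏ j ∈ range (n + 1), (s + (j : ℝ))) := by
        gcongr
    _ = _ := by ring

lemma gammaSeq_mono {s : ℝ} (hs : 0 < s) {m n : ℕ} (hm : m ≠ 0) (hmn : m ≤ n) :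
    Real.GammaSeq s m ≤ Real.GammaSeq s n := by
  induction n, hmn using Nat.le_induction with
  | base => rfl
  | succ n hmn ih => exact ih.trans (gammaSeq_le_succ hs (by omega))

lemma pow_div_gammaSeq (a x : ℝ) {n : ℕ} (hn : n ≠ 0) (j : ℕ) :
    x ^ j / Real.GammaSeq (a * j + a) n =
      (n + 1) / (n : ℝ) ^ a * ((x / (n : ℝ) ^ a) ^ j * Ring.multichoose (a * j + a) (n + 1)) := by
  have hn' : (0 : ℝ) < n := by exact_mod_cast Nat.pos_of_ne_zero hn
  rw [multichoose_eq_prod_div, Real.GammaSeq, Real.rpow_add hn', Real.rpow_mul hn'.le,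
    Real.rpow_natCast, Nat.factorial_succ, div_pow]
  push_cast
  field_simp

lemma summable_pow_div_gammaSeq {a : ℝ} (h0 : 0 ≤ a) (h1 : a ≤ 1) {x : ℝ} {n : ℕ} (hn : n ≠ 0)
    (hx : |x| < (n : ℝ) ^ a) :
    Summable fun j : ℕ => x ^ j / Real.GammaSeq (a * j + a) n := by
  simp only [pow_div_gammaSeq a x hn]
  have hpos : 0 < (n : ℝ) ^ a := (abs_nonneg x).trans_lt hx
  refine (summable_pow_mul_multichoose h0 h1 ?_ (n + 1)).mul_left _
  rwa [abs_div, abs_of_pos hpos, div_lt_one hpos]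

lemma tsum_neg_pow_div_gammaSeq (a y : ℝ) {n : ℕ} (hn : n ≠ 0) :
    ∑' j : ℕ, (-y) ^ j / Real.GammaSeq (a * j + a) n =
      (n + 1) / (n : ℝ) ^ a * resolventCoeff a (y / (n : ℝ) ^ a) (n + 1) := by
  simp only [pow_div_gammaSeq a (-y) hn, tsum_mul_left, resolventCoeff, neg_div]

lemma eventually_lt_natCast_rpow {a : ℝ} (h0 : 0 < a) (x : ℝ) :
    ∀ᶠ n : ℕ in atTop, n ≠ 0 ∧ x < (n : ℝ) ^ a :=
  (eventually_ne_atTop 0).and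
    (((tendsto_rpow_atTop h0).comp tendsto_natCast_atTop_atTop).eventually_gt_atTop x)

lemma gammaSeq_le_Gamma {s : ℝ} (hs : 0 < s) {n : ℕ} (hn : n ≠ 0) :
    Real.GammaSeq s n ≤ Real.Gamma s :=
  ge_of_tendsto (Real.GammaSeq_tendsto_Gamma s)
    ((eventually_ge_atTop n).mono fun _ h => gammaSeq_mono hs hn h)

section MittagLeffler

variable {α : ℝ}

lemma summable_mittagLeffler (hα : 0 < α) (hα1 : α ≤ 1) (x : ℝ) :
    Summable fun j : ℕ => x ^ j / Real.Gamma (α * j + α) := by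
  obtain ⟨n, hn, hx⟩ := (eventually_lt_natCast_rpow hα |x|).exists
  refine Summable.of_norm_bounded (g := fun j : ℕ => |x| ^ j / Real.GammaSeq (α * j + α) n)
    (summable_pow_div_gammaSeq hα.le hα1 hn (by rwa [abs_abs])) fun j => ?_
  have hs : 0 < α * j + α := by positivity
  rw [norm_div, norm_pow, Real.norm_eq_abs, Real.norm_eq_abs, abs_of_pos (Real.Gamma_pos_of_pos hs)]
  have := gammaSeq_pos hs hn
  gcongr
  exact gammaSeq_le_Gamma hs hn

/-- The Mittag-Leffler series is the termwise limit of its discretisations. -/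
lemma tendsto_tsum_pow_div_gammaSeq (hα : 0 < α) (hα1 : α ≤ 1) (x : ℝ) :
    Tendsto (fun n : ℕ => ∑' j : ℕ, x ^ j / Real.GammaSeq (α * j + α) n) atTop
      (𝓝 (∑' j : ℕ, x ^ j / Real.Gamma (α * j + α))) := by
  obtain ⟨n, hn, hx⟩ := (eventually_lt_natCast_rpow hα |x|).exists
  refine tendsto_tsum_of_dominated_convergence
    (bound := fun j : ℕ => |x| ^ j / Real.GammaSeq (α * j + α) n)
    (summable_pow_div_gammaSeq hα.le hα1 hn (by rwa [abs_abs])) (fun j => ?_) ?_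
  · have hs : 0 < α * j + α := by positivity
    exact tendsto_const_nhds.div (Real.GammaSeq_tendsto_Gamma _) (Real.Gamma_pos_of_pos hs).ne'
  · filter_upwards [eventually_ge_atTop n] with m hm j
    have hs : 0 < α * j + α := by positivity
    have := gammaSeq_pos hs hn
    rw [norm_div, norm_pow, Real.norm_eq_abs, Real.norm_eq_abs,
      abs_of_pos (gammaSeq_pos hs (by omega))]
    gcongr
    exact gammaSeq_mono hs hn hm

lemma mittagLeffler_neg_nonneg (hα : 0 < α) (hα1 : α ≤ 1) {y : ℝ} (hy : 0 ≤ y) :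
    0 ≤ ∑' j : ℕ, (-y) ^ j / Real.Gamma (α * j + α) := by
  refine ge_of_tendsto (tendsto_tsum_pow_div_gammaSeq hα hα1 (-y)) ?_
  filter_upwards [eventually_lt_natCast_rpow hα y] with n ⟨hn, hyn⟩
  rw [tsum_neg_pow_div_gammaSeq α y hn]
  have hpos := hy.trans_lt hyn
  exact mul_nonneg (by positivity)
    (resolventCoeff_nonneg hα.le hα1 (by positivity) ((div_lt_one hpos).mpr hyn) _)

lemma mittagLeffler_neg_anti (hα : 0 < α) (hα1 : α ≤ 1) {y z : ℝ} (hy : 0 ≤ y) (hyz : y ≤ z) :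
    ∑' j : ℕ, (-z) ^ j / Real.Gamma (α * j + α) ≤ ∑' j : ℕ, (-y) ^ j / Real.Gamma (α * j + α) := by
  refine le_of_tendsto_of_tendsto (tendsto_tsum_pow_div_gammaSeq hα hα1 (-z))
    (tendsto_tsum_pow_div_gammaSeq hα hα1 (-y)) ?_
  filter_upwards [eventually_lt_natCast_rpow hα z] with n ⟨hn, hzn⟩
  rw [tsum_neg_pow_div_gammaSeq α y hn, tsum_neg_pow_div_gammaSeq α z hn]
  have hpos := (hy.trans hyz).trans_lt hzn
  gcongr
  exact resolventCoeff_anti hα.le hα1 (by positivity) (by gcongr) ((div_lt_one hpos).mpr hzn) _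

lemma analyticOnNhd_mittagLeffler (hα : 0 < α) (hα1 : α ≤ 1) :
    AnalyticOnNhd ℝ (fun x : ℝ => ∑' j : ℕ, x ^ j / Real.Gamma (α * j + α)) Set.univ := by
  have hrad : (FormalMultilinearSeries.ofScalars ℝ
      fun j : ℕ => (Real.Gamma (α * j + α))⁻¹).radius = ⊤ := by
    refine FormalMultilinearSeries.radius_eq_top_of_summable_norm _ fun r => ?_
    refine (summable_mittagLeffler hα hα1 r).congr fun j => ?_
    rw [FormalMultilinearSeries.ofScalars_norm, norm_inv,
      Real.norm_of_nonneg (Real.Gamma_pos_of_pos (by positivity)).le, div_eq_inv_mul]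
  have hfun : (fun x : ℝ => ∑' j : ℕ, x ^ j / Real.Gamma (α * j + α)) =
      (FormalMultilinearSeries.ofScalars ℝ fun j : ℕ => (Real.Gamma (α * j + α))⁻¹).sum := by
    funext x
    refine tsum_congr fun j => ?_
    rw [FormalMultilinearSeries.ofScalars_apply_eq, smul_eq_mul, div_eq_inv_mul]
  rw [hfun]
  intro x _
  refine (FormalMultilinearSeries.hasFPowerSeriesOnBall _ (by simp [hrad])).analyticAt_of_mem ?_
  simp [hrad]

lemma mittagLeffler_pos_of_nonneg (hα : 0 < α) (hα1 : α ≤ 1) {x : ℝ} (hx : 0 ≤ x) :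
    0 < ∑' n : ℕ, x ^ n / Real.Gamma (α * n + α) := by
  refine (summable_mittagLeffler hα hα1 x).tsum_pos (fun n => ?_) 0 ?_
  · have := Real.Gamma_pos_of_pos (show 0 < α * n + α by positivity)
    positivity
  · simpa using Real.Gamma_pos_of_pos hα

end MittagLeffler

/-- Strict positivity of the two-parameter Mittag-Leffler function:
for `0 < α ≤ 1` and every real `x`, `E_{α,α}(x) = ∑ xⁿ / Γ(αn+α) > 0`. -/
theorem mittagLeffler_pos
    (α : ℝ) (hα : 0 < α) (hα1 : α ≤ 1) (x : ℝ) :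
    0 < ∑' n : ℕ, x ^ n / Real.Gamma (α * n + α) := by
  rcases le_or_gt 0 x with hx | hx
  · exact mittagLeffler_pos_of_nonneg hα hα1 hx
  have hnonneg : ∀ w ≤ 0, 0 ≤ ∑' n : ℕ, w ^ n / Real.Gamma (α * n + α) := fun w hw => by
    simpa using mittagLeffler_neg_nonneg hα hα1 (neg_nonneg.mpr hw)
  refine lt_of_le_of_ne (hnonneg x hx.le) fun hzero => ?_
  have hev : (fun w : ℝ => ∑' n : ℕ, w ^ n / Real.Gamma (α * n + α)) =ᶠ[𝓝 (x - 1)] 0 := by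
    filter_upwards [Iio_mem_nhds (show x - 1 < x by linarith)] with w hw
    have hw : w < x := hw
    refine le_antisymm ?_ (hnonneg w (hw.trans hx).le)
    have := mittagLeffler_neg_anti hα hα1 (neg_nonneg.mpr hx.le) (neg_le_neg hw.le)
    simp only [neg_neg] at this
    exact this.trans hzero.ge
  have h0 := (analyticOnNhd_mittagLeffler hα hα1).eqOn_zero_of_preconnected_of_eventuallyEq_zero
    isPreconnected_univ (Set.mem_univ (x - 1)) hev (Set.mem_univ 0)
  exact (mittagLeffler_pos_of_nonneg hα hα1 le_rfl).ne' h0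
end
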